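/- arXiv:1310.8374 — 3 statements merged into one kernel-verified Lean document; each statement's English description precedes it below -/
import Mathlib

section
/- Let X be a nonnegative integrable real random variable on a probability space (Ω, P), and let ω be a real number with P(X ≤ ω) = 1/2. Then for every measurable event Θ with P(Θ) ≥ 1/2, one has E[X | Θ] ≥ E[X | X ≤ ω]; equivalently, E[X·1_Θ]/P(Θ) ≥ 2·E[X·1_{X ≤ ω}]. -/
open MeasureTheory
open scoped ENNReal

/-- **Conditioning below the median minimizes the conditional mean.** If `X ≥ 0` is
integrable with median `w` (i.e. `P(X ≤ w) = 1/2`), then for every event `Θ` with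
`P(Θ) ≥ 1/2` one has `E[X | Θ] ≥ E[X | X ≤ w]`, i.e.
`E[X·1_Θ]/P(Θ) ≥ 2·E[X·1_{X ≤ w}]`. -/
theorem stmt_7 {Ω : Type*} [MeasurableSpace Ω] (P : Measure Ω)
    [IsProbabilityMeasure P] (X : Ω → ℝ) (hXmeas : Measurable X)
    (hXnn : ∀ ω, 0 ≤ X ω) (hXint : Integrable X P)
    (w : ℝ) (hmed : P {ω | X ω ≤ w} = 1 / 2)
    (Θ : Set Ω) (hΘ : MeasurableSet Θ) (hPΘ : (1 / 2 : ℝ≥0∞) ≤ P Θ) :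
    2 * ∫ ω in {ω | X ω ≤ w}, X ω ∂P
      ≤ (∫ ω in Θ, X ω ∂P) / (P Θ).toReal := by
  have hA : P.real {ω | X ω ≤ w} = 1 / 2 := by simp [measureReal_def, hmed]
  have hp : 1 / 2 ≤ P.real Θ := by
    simpa [measureReal_def] using ENNReal.toReal_mono (measure_ne_top P Θ) hPΘ
  have hshift (s : Set Ω) :
      ∫ ω in s, (X ω - w) ∂P = (∫ ω in s, X ω ∂P) - P.real s * w := by
    rw [integral_sub hXint.integrableOn (integrable_const w)]
    simp
  have hmin : ∫ ω in {ω | X ω ≤ w}, (X ω - w) ∂P ≤ ∫ ω in Θ, (X ω - w) ∂P := by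
    simpa only [sub_nonpos] using setIntegral_nonpos_le hΘ
      (hXmeas.sub_const w).stronglyMeasurable (hXint.sub (integrable_const w))
  have hle : ∫ ω in {ω | X ω ≤ w}, (X ω - w) ∂P ≤ 0 :=
    setIntegral_nonpos (measurableSet_le hXmeas measurable_const) fun _ h ↦ sub_nonpos.2 h
  rw [hshift, hA] at hle
  rw [hshift, hshift, hA] at hmin
  rw [← measureReal_def, le_div_iff₀ (by linarith)]
  nlinarith [mul_nonneg (sub_nonneg.2 hp) (neg_nonneg.2 hle)]
end

section
/- Let X be a real random variable on a probability space (Ω, P) that is exponentially distributed with rate r > 0. Then for every measurable event Θ with P(Θ) ≥ 1/2, one has E[X·1_Θ] ≥ P(Θ)·(1 − log 2)/r; i.e., E[X | Θ] ≥ (1 − log 2)/r. -/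
open MeasureTheory
open scoped ENNReal

/-- `X` is exponentially distributed with rate `r` under `P`:
`P(X > t) = e^{-r t}` for every `t ≥ 0`. -/
def IsExponentialRV {Ω : Type*} [MeasurableSpace Ω] (P : Measure Ω)
    (X : Ω → ℝ) (r : ℝ) : Prop :=
  ∀ t : ℝ, 0 ≤ t → P {ω | t < X ω} = ENNReal.ofReal (Real.exp (-(r * t)))

namespace IsExponentialRV

variable {Ω : Type*} [MeasurableSpace Ω] {P : Measure Ω} {X : Ω → ℝ} {r : ℝ}

theorem ae_pos [IsProbabilityMeasure P] (hX : Measurable X) (h : IsExponentialRV P X r) :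
    ∀ᵐ ω ∂P, 0 < X ω := by
  have h0 : P {ω | 0 < X ω} = 1 := by simpa using h 0 le_rfl
  exact (mem_ae_iff_prob_eq_one (measurableSet_lt measurable_const hX)).2 h0

theorem integrable [IsProbabilityMeasure P] (hX : Measurable X) (hr : 0 < r)
    (h : IsExponentialRV P X r) : Integrable X P := by
  have hnn : 0 ≤ᵐ[P] X := (h.ae_pos hX).mono fun _ hω => hω.le
  refine ⟨hX.aestronglyMeasurable, ?_⟩
  rw [hasFiniteIntegral_iff_ofReal hnn, lintegral_eq_lintegral_meas_lt P hnn hX.aemeasurable,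
    setLIntegral_congr_fun measurableSet_Ioi fun t ht => h t (le_of_lt ht)]
  have hint : IntegrableOn (fun t => Real.exp (-(r * t))) (Set.Ioi 0) := by
    simpa [neg_mul] using exp_neg_integrableOn_Ioi 0 hr
  exact (hasFiniteIntegral_iff_ofReal
    (Filter.Eventually.of_forall fun t => (Real.exp_pos _).le)).1 hint.2

/-- The truncated mean `E[min(X, a)] = (1 - e^{-r a}) / r` of an exponential variable. -/
theorem integral_min [IsProbabilityMeasure P] (hX : Measurable X) (hr : 0 < r)
    (h : IsExponentialRV P X r) {a : ℝ} (ha : 0 ≤ a) :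
    ∫ ω, min (X ω) a ∂P = (1 - Real.exp (-(r * a))) / r := by
  have hnn : 0 ≤ᵐ[P] fun ω => min (X ω) a :=
    (h.ae_pos hX).mono fun _ hω => le_min hω.le ha
  have hint : Integrable (fun ω => min (X ω) a) P :=
    (h.integrable hX hr).inf (integrable_const a)
  have htail : ∀ t ∈ Set.Ioi (0 : ℝ), P.real {ω | t < min (X ω) a} =
      (Set.Iio a).indicator (fun t => Real.exp (-(r * t))) t := by
    intro t ht
    by_cases hta : t < a
    · simp [hta, measureReal_def, h t (le_of_lt ht), (Real.exp_pos _).le]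
    · simp [hta]
  rw [hint.integral_eq_integral_meas_lt hnn, setIntegral_congr_fun measurableSet_Ioi htail,
    setIntegral_indicator measurableSet_Iio, Set.Ioi_inter_Iio, ← integral_Ioc_eq_integral_Ioo,
    ← intervalIntegral.integral_of_le ha]
  have hderiv : ∀ t ∈ Set.uIcc 0 a,
      HasDerivAt (fun t => -Real.exp (-(r * t)) / r) (Real.exp (-(r * t))) t := by
    intro t _
    refine HasDerivAt.congr_deriv
      ((((hasDerivAt_id t).const_mul r).neg.exp).neg.div_const r) ?_
    simp [hr.ne']
  rw [intervalIntegral.integral_eq_sub_of_hasDerivAt hderiv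
    (Continuous.intervalIntegrable (by fun_prop) _ _)]
  simp
  ring

end IsExponentialRV

/-- **Lower bound on conditional means of an exponential.** If `X` is exponential
with rate `r > 0`, then for every event `Θ` with `P(Θ) ≥ 1/2`,
`E[X·1_Θ] ≥ P(Θ)·(1 − log 2)/r`, i.e. `E[X | Θ] ≥ (1 − log 2)/r`. -/
theorem stmt_8 {Ω : Type*} [MeasurableSpace Ω] (P : Measure Ω)
    [IsProbabilityMeasure P] (X : Ω → ℝ) (hXmeas : Measurable X)
    (r : ℝ) (hr : 0 < r) (hexp : IsExponentialRV P X r)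
    (Θ : Set Ω) (hΘ : MeasurableSet Θ) (hPΘ : (1 / 2 : ℝ≥0∞) ≤ P Θ) :
    (P Θ).toReal * ((1 - Real.log 2) / r) ≤ (∫ ω in Θ, X ω ∂P) ∧
    (1 - Real.log 2) / r ≤ (∫ ω in Θ, X ω ∂P) / (P Θ).toReal := by
  have hX := hexp.integrable hXmeas hr
  set p := (P Θ).toReal with hp
  have hp_half : 1 / 2 ≤ p := by
    simpa using ENNReal.toReal_mono (measure_ne_top P Θ) hPΘ
  have hlog : 0 < Real.log 2 := Real.log_pos one_lt_two
  set a := Real.log 2 / r with ha_def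
  have ha : 0 ≤ a := (div_pos hlog hr).le
  have hmin : ∫ ω, min (X ω) a ∂P = 1 / 2 / r := by
    rw [hexp.integral_min hXmeas hr ha, ha_def, mul_div_cancel₀ _ hr.ne', Real.exp_neg,
      Real.exp_log two_pos]
    norm_num
  have hmin_int : Integrable (fun ω => min (X ω) a) P := hX.inf (integrable_const a)
  have hind_int : Integrable (Θ.indicator fun _ => a) P := (integrable_const a).indicator hΘ
  have hle : ∫ ω, (Θ.indicator (fun _ => a) ω - a + min (X ω) a) ∂P ≤ ∫ ω in Θ, X ω ∂P := by
    rw [← integral_indicator hΘ]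
    refine integral_mono ((hind_int.sub (integrable_const a)).add hmin_int)
      (hX.indicator hΘ) fun ω => ?_
    by_cases hω : ω ∈ Θ <;> simp [hω]
  have heq : ∫ ω, (Θ.indicator (fun _ => a) ω - a + min (X ω) a) ∂P =
      p * a - a + 1 / 2 / r := by
    have hsub : Integrable (fun ω => Θ.indicator (fun _ => a) ω - a) P :=
      hind_int.sub (integrable_const a)
    rw [integral_add hsub hmin_int,
      integral_sub hind_int (integrable_const a), hmin, integral_indicator hΘ]
    simp [measureReal_def, hp]
  have hbound : p * ((1 - Real.log 2) / r) ≤ p * a - a + 1 / 2 / r := by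
    have hlog_half : 1 / 2 < Real.log 2 := by linarith [Real.log_two_gt_d9]
    have : p * (1 - Real.log 2) ≤ p * Real.log 2 - Real.log 2 + 1 / 2 := by nlinarith
    calc p * ((1 - Real.log 2) / r) = p * (1 - Real.log 2) / r := by ring
      _ ≤ (p * Real.log 2 - Real.log 2 + 1 / 2) / r := by gcongr
      _ = p * a - a + 1 / 2 / r := by rw [ha_def]; ring
  have hmain : p * ((1 - Real.log 2) / r) ≤ ∫ ω in Θ, X ω ∂P :=
    hbound.trans (heq ▸ hle)
  refine ⟨hmain, ?_⟩
  rw [le_div_iff₀ (by linarith), mul_comm]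
  exact hmain
end

section
/- Let X be a real random variable on a probability space (Ω, P) that is exponentially distributed with rate r > 0. Then the infimum of E[X | Θ] over all measurable events Θ with P(Θ) ≥ 1/2 equals (1 − log 2)/r, and it is attained by the event Θ = {X ≤ (log 2)/r}. -/
open MeasureTheory
open scoped ENNReal

open Set in
/-- The expected excess over a level `c ≥ 0` of an exponential variable, as a Lebesgue integral. -/
lemma IsExponentialRV.lintegral_excess {Ω : Type*} [MeasurableSpace Ω] {P : Measure Ω}
    {X : Ω → ℝ} (hX : Measurable X) {r : ℝ} (hr : 0 < r) (h : IsExponentialRV P X r)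
    {c : ℝ} (hc : 0 ≤ c) :
    ∫⁻ ω, ENNReal.ofReal (max (X ω - c) 0) ∂P = ENNReal.ofReal (Real.exp (-(r * c)) / r) := by
  rw [lintegral_eq_lintegral_meas_lt P (.of_forall fun ω => le_max_right (X ω - c) 0)
    (by fun_prop)]
  have tail : ∀ t ∈ Ioi (0 : ℝ), P {ω | t < max (X ω - c) 0}
      = ENNReal.ofReal (Real.exp (-(r * c)) * Real.exp (-r * t)) := by
    intro t ht
    rw [mem_Ioi] at ht
    have hset : {ω | t < max (X ω - c) 0} = {ω | c + t < X ω} := by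
      ext ω
      simp only [mem_ofPred_eq, lt_max_iff, ht.not_gt, or_false, lt_sub_iff_add_lt']
    rw [hset, h _ (by positivity), ← Real.exp_add]
    ring_nf
  rw [setLIntegral_congr_fun measurableSet_Ioi tail, ← ofReal_integral_eq_lintegral_ofReal
    ((exp_neg_integrableOn_Ioi 0 hr).const_mul _)
    (Filter.Eventually.of_forall fun t => by positivity), integral_const_mul,
    integral_exp_mul_Ioi (neg_lt_zero.mpr hr)]
  congr 1
  simp [div_eq_mul_inv]

lemma IsExponentialRV.integrable_excess {Ω : Type*} [MeasurableSpace Ω] {P : Measure Ω}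
    {X : Ω → ℝ} (hX : Measurable X) {r : ℝ} (hr : 0 < r) (h : IsExponentialRV P X r)
    {c : ℝ} (hc : 0 ≤ c) : Integrable (fun ω => max (X ω - c) 0) P := by
  refine ⟨by fun_prop, ?_⟩
  rw [hasFiniteIntegral_iff_ofReal (.of_forall fun ω => le_max_right (X ω - c) 0),
    h.lintegral_excess hX hr hc]
  exact ENNReal.ofReal_lt_top

/-- The expected excess over a level `c ≥ 0` of an exponential variable. -/
lemma IsExponentialRV.integral_excess {Ω : Type*} [MeasurableSpace Ω] {P : Measure Ω}
    {X : Ω → ℝ} (hX : Measurable X) {r : ℝ} (hr : 0 < r) (h : IsExponentialRV P X r)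
    {c : ℝ} (hc : 0 ≤ c) : ∫ ω, max (X ω - c) 0 ∂P = Real.exp (-(r * c)) / r := by
  rw [integral_eq_lintegral_of_nonneg_ae (.of_forall fun ω => le_max_right (X ω - c) 0)
    (by fun_prop), h.lintegral_excess hX hr hc, ENNReal.toReal_ofReal (by positivity)]

lemma IsExponentialRV.ae_pos_s9 {Ω : Type*} [MeasurableSpace Ω] {P : Measure Ω}
    [IsProbabilityMeasure P] {X : Ω → ℝ} (hX : Measurable X) {r : ℝ}
    (h : IsExponentialRV P X r) : ∀ᵐ ω ∂P, 0 < X ω := by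
  refine (prob_compl_eq_zero_iff (measurableSet_lt measurable_const hX)).mpr ?_
  simpa using h 0 le_rfl

lemma IsExponentialRV.ae_eq_excess_zero {Ω : Type*} [MeasurableSpace Ω] {P : Measure Ω}
    [IsProbabilityMeasure P] {X : Ω → ℝ} (hX : Measurable X) {r : ℝ}
    (h : IsExponentialRV P X r) : (fun ω => max (X ω - 0) 0) =ᵐ[P] X := by
  filter_upwards [h.ae_pos_s9 hX] with ω hω
  simp [hω.le]

lemma IsExponentialRV.integrable_s9 {Ω : Type*} [MeasurableSpace Ω] {P : Measure Ω}
    [IsProbabilityMeasure P] {X : Ω → ℝ} (hX : Measurable X) {r : ℝ} (hr : 0 < r)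
    (h : IsExponentialRV P X r) : Integrable X P :=
  (h.integrable_excess hX hr le_rfl).congr (h.ae_eq_excess_zero hX)

/-- The mean of an exponential variable. -/
lemma IsExponentialRV.integral_eq {Ω : Type*} [MeasurableSpace Ω] {P : Measure Ω}
    [IsProbabilityMeasure P] {X : Ω → ℝ} (hX : Measurable X) {r : ℝ} (hr : 0 < r)
    (h : IsExponentialRV P X r) : ∫ ω, X ω ∂P = 1 / r := by
  rw [← integral_congr_ae (h.ae_eq_excess_zero hX), h.integral_excess hX hr le_rfl]
  simp

/-- The expected shortfall below a level `c ≥ 0` of an exponential variable. -/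
lemma IsExponentialRV.integral_shortfall {Ω : Type*} [MeasurableSpace Ω] {P : Measure Ω}
    [IsProbabilityMeasure P] {X : Ω → ℝ} (hX : Measurable X) {r : ℝ} (hr : 0 < r)
    (h : IsExponentialRV P X r) {c : ℝ} (hc : 0 ≤ c) :
    ∫ ω, max (c - X ω) 0 ∂P = c - 1 / r + Real.exp (-(r * c)) / r := by
  have hi := h.integrable_s9 hX hr
  have heq : ∀ ω, max (c - X ω) 0 = (c - X ω) + max (X ω - c) 0 := by
    intro ω
    rcases le_total (X ω) c with hle | hle
    · rw [max_eq_left (by linarith), max_eq_right (by linarith), add_zero]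
    · rw [max_eq_right (by linarith), max_eq_left (by linarith)]
      ring
  simp_rw [heq]
  rw [integral_add (f := fun ω => c - X ω) ((integrable_const c).sub hi)
    (h.integrable_excess hX hr hc),
    integral_sub (integrable_const c) hi, h.integral_excess hX hr hc, h.integral_eq hX hr]
  simp

/-- **The infimum of `E[X | Θ]` over events with `P(Θ) ≥ 1/2`.** If `X` is
exponential with rate `r > 0`, the infimum of `E[X | Θ] = E[X·1_Θ]/P(Θ)` over
all measurable `Θ` with `P(Θ) ≥ 1/2` equals `(1 − log 2)/r`, and it is attained
by `Θ = {X ≤ (log 2)/r}`. -/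
theorem stmt_9 {Ω : Type*} [MeasurableSpace Ω] (P : Measure Ω)
    [IsProbabilityMeasure P] (X : Ω → ℝ) (hXmeas : Measurable X)
    (r : ℝ) (hr : 0 < r) (hexp : IsExponentialRV P X r) :
    IsLeast {x : ℝ | ∃ Θ : Set Ω, MeasurableSet Θ ∧ (1 / 2 : ℝ≥0∞) ≤ P Θ ∧
        x = (∫ ω in Θ, X ω ∂P) / (P Θ).toReal} ((1 - Real.log 2) / r) ∧
    (∫ ω in {ω | X ω ≤ Real.log 2 / r}, X ω ∂P)
        / (P {ω | X ω ≤ Real.log 2 / r}).toReal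
      = (1 - Real.log 2) / r := by
  set m := Real.log 2 / r with hm
  have hm0 : 0 ≤ m := div_nonneg (Real.log_nonneg one_le_two) hr.le
  have hexpm : Real.exp (-(r * m)) = 1 / 2 := by
    rw [hm, mul_div_cancel₀ _ hr.ne', Real.exp_neg, Real.exp_log two_pos, one_div]
  have hi := hexp.integrable_s9 hXmeas hr
  have hint : Integrable (fun ω => m - X ω) P := (integrable_const m).sub hi
  have hpos : Integrable (fun ω => max (m - X ω) 0) P := hint.pos_part
  have hshort : ∫ ω, max (m - X ω) 0 ∂P = m - 1 / (2 * r) := by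
    rw [hexp.integral_shortfall hXmeas hr hm0, hexpm]
    field_simp
    ring
  have hshort0 : 0 ≤ m - 1 / (2 * r) := hshort ▸ integral_nonneg fun ω => le_max_right _ _
  have hvalue : (1 - Real.log 2) / r = m - 2 * (m - 1 / (2 * r)) := by
    rw [hm]
    field_simp
    ring
  have hsplit : ∀ Θ : Set Ω, ∫ ω in Θ, (m - X ω) ∂P = m * (P Θ).toReal - ∫ ω in Θ, X ω ∂P := by
    intro Θ
    rw [integral_sub (integrable_const m) hi.integrableOn, setIntegral_const, smul_eq_mul,
      mul_comm, measureReal_def]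
  have hΘ : MeasurableSet {ω | X ω ≤ m} := measurableSet_le hXmeas measurable_const
  have hprob : P {ω | X ω ≤ m} = 1 / 2 := by
    have hcompl : {ω | X ω ≤ m} = {ω | m < X ω}ᶜ := by ext ω; simp
    rw [hcompl, prob_compl_eq_one_sub (measurableSet_lt measurable_const hXmeas), hexp m hm0,
      hexpm, ENNReal.ofReal_div_of_pos two_pos]
    simp
  have hattain : (∫ ω in {ω | X ω ≤ m}, X ω ∂P) / (P {ω | X ω ≤ m}).toReal
      = (1 - Real.log 2) / r := by
    have hfull : ∫ ω in {ω | X ω ≤ m}, (m - X ω) ∂P = m - 1 / (2 * r) := by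
      rw [← hshort, ← integral_indicator hΘ]
      congr 1 with ω
      by_cases hω : X ω ≤ m
      · simp [Set.indicator, hω]
      · simp [Set.indicator, hω, (not_le.mp hω).le]
    rw [hsplit, hprob] at hfull
    rw [hprob, hvalue]
    simp only [one_div, ENNReal.toReal_inv, ENNReal.toReal_ofNat] at hfull ⊢
    rw [div_inv_eq_mul]
    linarith
  refine ⟨⟨⟨_, hΘ, hprob.ge, hattain.symm⟩, ?_⟩, hattain⟩
  rintro x ⟨Θ, -, hhalf, rfl⟩
  have hp : 1 / 2 ≤ (P Θ).toReal := by
    simpa using ENNReal.toReal_mono (measure_ne_top P Θ) hhalf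
  have hle : ∫ ω in Θ, (m - X ω) ∂P ≤ m - 1 / (2 * r) := by
    rw [← hshort]
    exact (integral_mono hint.integrableOn hpos.integrableOn fun ω => le_max_left _ _).trans
      (setIntegral_le_integral hpos (Filter.Eventually.of_forall fun ω => le_max_right _ _))
  rw [hsplit] at hle
  rw [hvalue, le_div_iff₀ (by linarith)]
  nlinarith
end
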